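/- The map T ↦ T∘E_ξ, where E_ξ : h₁ → h₁⊗H is the bounded operator c ↦ c⊗ξ, is a linear bijection from Op_M(h₁⊗̲Ξ; h₂⊗H) — the space of linear operators T from h₁⊗H to h₂⊗H with domain the algebraic tensor product h₁⊗̲Ξ satisfying (I_{h₂}⊗u*)T(I_{h₁}⊗u) = T for every unitary u ∈ M′ — onto the space of ALL linear maps from h₁ to h₂⊗H; its inverse sends B to the unique operator B^ξ with domain h₁⊗̲Ξ satisfying B^ξ(c⊗x′ξ) = (I_{h₂}⊗x′)Bc for all c ∈ h₁ and x′ ∈ M′ (this prescription is well defined). Moreover, the bijection restricts to a bijection from Op‡_M(h₁⊗̲Ξ, h₂⊗̲Ξ) := {T ∈ Op_M(h₁⊗̲Ξ; h₂⊗H) : Dom T* ⊇ h₂⊗̲Ξ} onto B‡_{M,ξ}(h₁; h₂⊗H) := {bounded B : h₁ → h₂⊗H for which there exists a (necessarily unique) bounded B_† : h₂ → h₁⊗H with B*(I_{h₂}⊗x′)E_ξ = E^ξ(I_{h₁}⊗x′)B_† for all x′ ∈ M′, where E^ξ := (E_ξ)*}, and this restriction intertwines the dagger operations: (T E_ξ)_†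 = T† E_ξ and (B^ξ)† = (B_†)^ξ, where T† := (T*) restricted to h₂⊗̲Ξ. -/

import Mathlib

open scoped ComplexInnerProductSpace

/-!
STATEMENT 0.  Let `M` be a von Neumann algebra on a complex Hilbert space `H` with cyclic and
separating vector `ξ`, `Ξ := M′ξ`, and let `h₁`, `h₂` be complex Hilbert spaces.  The Hilbert
space tensor products `hᵢ ⊗ H` are realised abstractly as Hilbert spaces `Gᵢ` with bilinear
maps `tmᵢ` satisfying the characteristic inner-product identity and density property, and the
ampliations `I ⊗ u` (`u` bounded on `H`) are realised as the maps `ampᵢ u`, characterised by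
their action on elementary tensors.

Claims: the map `T ↦ T E_ξ` (`E_ξ : c ↦ c ⊗ ξ`) is a linear bijection from
`Op_M(h₁ ⊗̲ Ξ; h₂ ⊗ H)` onto all linear maps `h₁ → h₂ ⊗ H`, with inverse `B ↦ B^ξ` where
`B^ξ (c ⊗ x′ξ) = (I ⊗ x′)(B c)`; it restricts to a bijection from `Op‡_M(h₁ ⊗̲ Ξ, h₂ ⊗̲ Ξ)`
onto `B‡_{M,ξ}(h₁; h₂ ⊗ H)`, intertwining the dagger operations.
-/

/-- Membership in `Op_M(h₁ ⊗̲ Ξ; h₂ ⊗ H)`: the domain is the algebraic tensor product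
`h₁ ⊗̲ Ξ` and `(I ⊗ u*) T (I ⊗ u) = T` for every unitary `u ∈ M′`. -/
def OpMOf {H h₁ G₁ G₂ : Type*}
    [NormedAddCommGroup H] [InnerProductSpace ℂ H] [CompleteSpace H]
    [NormedAddCommGroup h₁] [InnerProductSpace ℂ h₁]
    [NormedAddCommGroup G₁] [InnerProductSpace ℂ G₁]
    [NormedAddCommGroup G₂] [InnerProductSpace ℂ G₂]
    (M : VonNeumannAlgebra H) (ξ : H)
    (tm₁ : h₁ →ₗ[ℂ] H →ₗ[ℂ] G₁)
    (amp₁ : (H →L[ℂ] H) → (G₁ →L[ℂ] G₁)) (amp₂ : (H →L[ℂ] H) → (G₂ →L[ℂ] G₂))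
    (T : G₁ →ₗ.[ℂ] G₂) : Prop :=
  T.domain = Submodule.span ℂ
      {z : G₁ | ∃ (a : h₁) (x : H →L[ℂ] H), x ∈ M.commutant ∧ z = tm₁ a (x ξ)} ∧
  ∀ u : H →L[ℂ] H, u ∈ M.commutant → u * star u = 1 → star u * u = 1 →
    (∀ z : G₁, amp₁ u z ∈ T.domain ↔ z ∈ T.domain) ∧
    (∀ (z : G₁) (hz : z ∈ T.domain) (hz' : amp₁ u z ∈ T.domain),
      amp₂ (star u) (T ⟨amp₁ u z, hz'⟩) = T ⟨z, hz⟩)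

section VonNeumann

variable {H : Type*} [NormedAddCommGroup H] [InnerProductSpace ℂ H] [CompleteSpace H]

/-- A von Neumann algebra as a complex subspace of the bounded operators. -/
def VonNeumannAlgebra.toSubmodule (M : VonNeumannAlgebra H) : Submodule ℂ (H →L[ℂ] H) :=
  Subalgebra.toSubmodule M.toStarSubalgebra.toSubalgebra

theorem VonNeumannAlgebra.isClosed_coe (M : VonNeumannAlgebra H) :
    IsClosed (M : Set (H →L[ℂ] H)) := by
  rw [← M.centralizer_centralizer]
  exact Set.isClosed_centralizer _

/-- A von Neumann algebra is spanned by its unitary elements. -/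
theorem VonNeumannAlgebra.mem_span_unitary (M : VonNeumannAlgebra H) {x : H →L[ℂ] H}
    (hx : x ∈ M) :
    x ∈ Submodule.span ℂ {u : H →L[ℂ] H | u ∈ M ∧ u * star u = 1 ∧ star u * u = 1} := by
  have hclosed : IsClosed (M.toStarSubalgebra : Set (H →L[ℂ] H)) := M.isClosed_coe
  let _ : CStarAlgebra (H →L[ℂ] H) := {}
  let _ : CStarAlgebra M.toStarSubalgebra := StarSubalgebra.cstarAlgebra _ (h_closed := hclosed)
  obtain ⟨u, c, hu, -⟩ := CStarAlgebra.exists_sum_four_unitary (⟨x, hx⟩ : M.toStarSubalgebra)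
  have hsum : x = ∑ i, c i • ((u i : M.toStarSubalgebra) : H →L[ℂ] H) := by
    simpa using congrArg Subtype.val hu
  rw [hsum]
  refine sum_mem fun i _ => Submodule.smul_mem _ _ (Submodule.subset_span ⟨?_, ?_, ?_⟩)
  · exact (u i : M.toStarSubalgebra).2
  · exact congrArg Subtype.val (Unitary.mul_star_self_of_mem (u i).2)
  · exact congrArg Subtype.val (Unitary.star_mul_self_of_mem (u i).2)

/-- A separating vector for `M` is cyclic for the commutant of `M`. -/
theorem VonNeumannAlgebra.dense_commutant_apply (M : VonNeumannAlgebra H) (ξ : H)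
    (hsep : ∀ x ∈ M, x ξ = 0 → x = 0) :
    Dense {y : H | ∃ x ∈ M.commutant, x ξ = y} := by
  set L : Submodule ℂ H :=
    M.commutant.toSubmodule.map (ContinuousLinearMap.apply ℂ H ξ).toLinearMap with hL
  have hmem : ∀ {y : H}, y ∈ L ↔ ∃ x ∈ M.commutant, x ξ = y := Iff.rfl
  have hset : {y : H | ∃ x ∈ M.commutant, x ξ = y} = (L : Set H) := rfl
  rw [hset, Submodule.dense_iff_topologicalClosure_eq_top]
  set K := L.topologicalClosure with hK
  have : CompleteSpace K := L.isClosed_topologicalClosure.completeSpace_coe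
  have hp : K.starProjection ∈ M := by
    rw [VonNeumannAlgebra.IsStarProjection.mem_iff isStarProjection_starProjection]
    intro y hy
    rw [Submodule.range_starProjection, Module.End.mem_invtSubmodule]
    intro z hz
    have hmaps : Set.MapsTo y (L : Set H) L := by
      rintro _ ⟨x, hx, rfl⟩
      exact hmem.2 ⟨y * x, mul_mem hy hx, rfl⟩
    exact hmaps.closure y.continuous hz
  have hξ : ξ ∈ K := L.le_topologicalClosure (hmem.2 ⟨1, one_mem _, rfl⟩)
  have h0 : (1 - K.starProjection : H →L[ℂ] H) = 0 := by
    refine hsep _ (sub_mem (one_mem M) hp) ?_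
    simp [Submodule.starProjection_eq_self_iff.2 hξ]
  rw [eq_top_iff]
  intro z _
  rw [← Submodule.starProjection_eq_self_iff]
  exact congrArg (fun f : H →L[ℂ] H => f z) (sub_eq_zero.1 h0).symm

/-- A cyclic vector for `M` is separating for the commutant of `M`. -/
theorem VonNeumannAlgebra.eq_zero_of_commutant_apply_eq_zero (M : VonNeumannAlgebra H) (ξ : H)
    (hcyc : Dense {y : H | ∃ x ∈ M, x ξ = y}) {x : H →L[ℂ] H} (hx : x ∈ M.commutant)
    (h0 : x ξ = 0) : x = 0 := by
  refine ContinuousLinearMap.coeFn_injective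
    (Continuous.ext_on hcyc x.continuous continuous_const ?_)
  rintro _ ⟨y, hy, rfl⟩
  have := congrArg (fun f : H →L[ℂ] H => f ξ) (VonNeumannAlgebra.mem_commutant_iff.1 hx y hy)
  simpa [h0] using this.symm

end VonNeumann

section ClosedGraph

variable {E F : Type*} [NormedAddCommGroup E] [InnerProductSpace ℂ E] [CompleteSpace E]
  [NormedAddCommGroup F] [InnerProductSpace ℂ F] [CompleteSpace F]

/-- A linear map between Hilbert spaces all of whose matrix coefficients against a dense subspace
are continuous is itself continuous. -/
theorem LinearMap.continuous_of_dense_inner (A : E →ₗ[ℂ] F) {S : Submodule ℂ F}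
    (hS : Dense (S : Set F)) (h : ∀ s ∈ S, Continuous fun e => ⟪s, A e⟫) : Continuous A := by
  refine A.continuous_of_seq_closed_graph fun u x y hu hy => ?_
  refine hS.eq_of_inner_right ℂ fun s hs => ?_
  exact tendsto_nhds_unique ((tendsto_const_nhds (x := s)).inner hy)
    (((h s hs).tendsto x).comp hu)

end ClosedGraph

section Ampliation

variable {H h G : Type*}
  [NormedAddCommGroup H] [InnerProductSpace ℂ H]
  [NormedAddCommGroup h] [InnerProductSpace ℂ h]
  [NormedAddCommGroup G] [InnerProductSpace ℂ G]
  {tm : h →ₗ[ℂ] H →ₗ[ℂ] G} {amp : (H →L[ℂ] H) → (G →L[ℂ] G)}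

theorem eq_of_eq_on_elementary {F : Type*} [NormedAddCommGroup F] [NormedSpace ℂ F]
    (hdense : Dense (Submodule.span ℂ {z : G | ∃ a b, z = tm a b} : Set G))
    {f g : G →L[ℂ] F} (hfg : ∀ a b, f (tm a b) = g (tm a b)) : f = g := by
  refine ContinuousLinearMap.ext_on hdense ?_
  rintro _ ⟨a, b, rfl⟩
  exact hfg a b

theorem amp_one (hdense : Dense (Submodule.span ℂ {z : G | ∃ a b, z = tm a b} : Set G))
    (hamp : ∀ (u : H →L[ℂ] H) (a : h) (b : H), amp u (tm a b) = tm a (u b)) : amp 1 = 1 :=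
  eq_of_eq_on_elementary hdense fun a b => by simp [hamp]

theorem amp_mul (hdense : Dense (Submodule.span ℂ {z : G | ∃ a b, z = tm a b} : Set G))
    (hamp : ∀ (u : H →L[ℂ] H) (a : h) (b : H), amp u (tm a b) = tm a (u b))
    (u v : H →L[ℂ] H) : amp (u * v) = amp u * amp v :=
  eq_of_eq_on_elementary hdense fun a b => by simp [hamp]

theorem amp_add (hdense : Dense (Submodule.span ℂ {z : G | ∃ a b, z = tm a b} : Set G))
    (hamp : ∀ (u : H →L[ℂ] H) (a : h) (b : H), amp u (tm a b) = tm a (u b))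
    (u v : H →L[ℂ] H) : amp (u + v) = amp u + amp v :=
  eq_of_eq_on_elementary hdense fun a b => by simp [hamp]

theorem amp_smul (hdense : Dense (Submodule.span ℂ {z : G | ∃ a b, z = tm a b} : Set G))
    (hamp : ∀ (u : H →L[ℂ] H) (a : h) (b : H), amp u (tm a b) = tm a (u b))
    (c : ℂ) (u : H →L[ℂ] H) : amp (c • u) = c • amp u :=
  eq_of_eq_on_elementary hdense fun a b => by simp [hamp]

theorem amp_star [CompleteSpace H] [CompleteSpace G]
    (hinner : ∀ (a c : h) (b d : H), ⟪tm a b, tm c d⟫ = ⟪a, c⟫ * ⟪b, d⟫)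
    (hdense : Dense (Submodule.span ℂ {z : G | ∃ a b, z = tm a b} : Set G))
    (hamp : ∀ (u : H →L[ℂ] H) (a : h) (b : H), amp u (tm a b) = tm a (u b))
    (u : H →L[ℂ] H) : amp (star u) = ContinuousLinearMap.adjoint (amp u) := by
  refine eq_of_eq_on_elementary hdense fun a b => ?_
  refine hdense.eq_of_inner_left ℂ fun s hs => ?_
  induction hs using Submodule.span_induction with
  | mem x hx =>
    obtain ⟨c, d, rfl⟩ := hx
    rw [ContinuousLinearMap.adjoint_inner_left, hamp, hamp, hinner, hinner,
      ContinuousLinearMap.star_eq_adjoint, ContinuousLinearMap.adjoint_inner_left]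
  | zero => simp
  | add x y _ _ hx hy => simp [inner_add_right, hx, hy]
  | smul c x _ hx => simp [inner_smul_right, hx]

theorem norm_elementary
    (hinner : ∀ (a c : h) (b d : H), ⟪tm a b, tm c d⟫ = ⟪a, c⟫ * ⟪b, d⟫) (a : h) (b : H) :
    ‖tm a b‖ = ‖a‖ * ‖b‖ := by
  have := hinner a a b b
  simp only [inner_self_eq_norm_sq_to_K] at this
  norm_cast at this
  rw [← mul_pow] at this
  exact (pow_left_inj₀ (by positivity) (by positivity) two_ne_zero).1 this

/-- An elementary tensor is continuous in its first variable. -/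
theorem continuous_elementary_left
    (hinner : ∀ (a c : h) (b d : H), ⟪tm a b, tm c d⟫ = ⟪a, c⟫ * ⟪b, d⟫) (b : H) :
    Continuous fun a => tm a b :=
  AddMonoidHomClass.continuous_of_bound (tm.flip b) ‖b‖ fun a => by
    simp [norm_elementary hinner, mul_comm]

theorem continuous_elementary_right
    (hinner : ∀ (a c : h) (b d : H), ⟪tm a b, tm c d⟫ = ⟪a, c⟫ * ⟪b, d⟫) (a : h) :
    Continuous (tm a) :=
  AddMonoidHomClass.continuous_of_bound (tm a) ‖a‖ fun b => by
    simp [norm_elementary hinner]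

open TensorProduct in
/-- The algebraic tensor product embeds into the Hilbert space tensor product. -/
theorem lift_injective
    (hinner : ∀ (a c : h) (b d : H), ⟪tm a b, tm c d⟫ = ⟪a, c⟫ * ⟪b, d⟫) :
    Function.Injective (TensorProduct.lift tm) := by
  have hiso : ∀ x y : h ⊗[ℂ] H, ⟪TensorProduct.lift tm x, TensorProduct.lift tm y⟫ = ⟪x, y⟫ := by
    intro x y
    induction x with
    | zero => simp
    | add x x' hx hx' => simp [inner_add_left, hx, hx']
    | tmul a b =>
      induction y with
      | zero => simp
      | add y y' hy hy' => rw [map_add, inner_add_right, inner_add_right, hy, hy']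
      | tmul c d => simp [hinner]
  rw [injective_iff_map_eq_zero]
  intro x hx
  rw [← inner_self_eq_zero (𝕜 := ℂ), ← hiso, hx, inner_zero_left]

variable [CompleteSpace H]

variable (M : VonNeumannAlgebra H) (ξ : H) (tm) in
/-- The algebraic tensor product `h ⊗̲ M′ξ` inside `h ⊗ H`. -/
def elementarySpan : Submodule ℂ G :=
  Submodule.span ℂ {z : G | ∃ (a : h) (x : H →L[ℂ] H), x ∈ M.commutant ∧ z = tm a (x ξ)}

variable {M : VonNeumannAlgebra H} {ξ : H}

theorem mem_elementarySpan (a : h) {x : H →L[ℂ] H} (hx : x ∈ M.commutant) :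
    tm a (x ξ) ∈ elementarySpan tm M ξ :=
  Submodule.subset_span ⟨a, x, hx, rfl⟩

theorem mem_elementarySpan_vector (a : h) : tm a ξ ∈ elementarySpan tm M ξ :=
  mem_elementarySpan a (x := 1) (one_mem _)

theorem dense_elementarySpan (hsep : ∀ x ∈ M, x ξ = 0 → x = 0)
    (hinner : ∀ (a c : h) (b d : H), ⟪tm a b, tm c d⟫ = ⟪a, c⟫ * ⟪b, d⟫)
    (hdense : Dense (Submodule.span ℂ {z : G | ∃ a b, z = tm a b} : Set G)) :
    Dense (elementarySpan tm M ξ : Set G) := by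
  have hle : Submodule.span ℂ {z : G | ∃ a b, z = tm a b} ≤
      (elementarySpan tm M ξ).topologicalClosure := by
    refine Submodule.span_le.2 ?_
    rintro _ ⟨a, b, rfl⟩
    have hmaps : Set.MapsTo (tm a) {y : H | ∃ x ∈ M.commutant, x ξ = y}
        (elementarySpan tm M ξ) := by
      rintro _ ⟨x, hx, rfl⟩
      exact mem_elementarySpan a hx
    exact hmaps.closure (continuous_elementary_right hinner a)
      (M.dense_commutant_apply ξ hsep b)
  exact dense_closure.1 (hdense.mono hle)

end Ampliation

section Operators

variable {H h₁ h₂ G₁ G₂ : Type*}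
  [NormedAddCommGroup H] [InnerProductSpace ℂ H] [CompleteSpace H]
  [NormedAddCommGroup h₁] [InnerProductSpace ℂ h₁]
  [NormedAddCommGroup h₂] [InnerProductSpace ℂ h₂]
  [NormedAddCommGroup G₁] [InnerProductSpace ℂ G₁]
  [NormedAddCommGroup G₂] [InnerProductSpace ℂ G₂]
  {M : VonNeumannAlgebra H} {ξ : H}
  {tm₁ : h₁ →ₗ[ℂ] H →ₗ[ℂ] G₁} {tm₂ : h₂ →ₗ[ℂ] H →ₗ[ℂ] G₂}
  {amp₁ : (H →L[ℂ] H) → (G₁ →L[ℂ] G₁)} {amp₂ : (H →L[ℂ] H) → (G₂ →L[ℂ] G₂)}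
  {T S : G₁ →ₗ.[ℂ] G₂}

/-- A linear condition on the values of a partial operator with domain `h₁ ⊗̲ M′ξ` holds as soon
as it holds on elementary tensors. -/
theorem eq_on_domain_of_eq_on_elementary {F : Type*} [AddCommGroup F] [Module ℂ F]
    (hdom : T.domain = elementarySpan tm₁ M ξ) {f g : T.domain →ₗ[ℂ] F}
    (hfg : ∀ (a : h₁) (x : H →L[ℂ] H), x ∈ M.commutant → ∀ hm : tm₁ a (x ξ) ∈ T.domain,
      f ⟨tm₁ a (x ξ), hm⟩ = g ⟨tm₁ a (x ξ), hm⟩) : f = g := by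
  have key : ∀ z, z ∈ elementarySpan tm₁ M ξ → ∃ hz : z ∈ T.domain, f ⟨z, hz⟩ = g ⟨z, hz⟩ := by
    intro z hz
    induction hz using Submodule.span_induction with
    | mem z hz =>
      obtain ⟨a, x, hx, rfl⟩ := hz
      have hm : tm₁ a (x ξ) ∈ T.domain := hdom ▸ mem_elementarySpan a hx
      exact ⟨hm, hfg a x hx hm⟩
    | zero => exact ⟨zero_mem _, (map_zero f).trans (map_zero g).symm⟩
    | add y z _ _ hy hz =>
      obtain ⟨hy, hfy⟩ := hy
      obtain ⟨hz, hfz⟩ := hz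
      exact ⟨add_mem hy hz, by
        rw [← AddMemClass.mk_add_mk _ y z hy hz, map_add, map_add, hfy, hfz]⟩
    | smul c z _ hz =>
      obtain ⟨hz, hfz⟩ := hz
      exact ⟨Submodule.smul_mem _ c hz, by
        rw [← SetLike.mk_smul_mk _ c z hz, map_smul, map_smul, hfz]⟩
  ext ⟨z, hz⟩
  exact (key z (hdom ▸ hz)).2

theorem ext_of_eq_on_elementary (hT : T.domain = elementarySpan tm₁ M ξ)
    (hS : S.domain = elementarySpan tm₁ M ξ)
    (h : ∀ (a : h₁) (x : H →L[ℂ] H), x ∈ M.commutant → ∀ (hm : tm₁ a (x ξ) ∈ T.domain)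
      (hm' : tm₁ a (x ξ) ∈ S.domain), T ⟨tm₁ a (x ξ), hm⟩ = S ⟨tm₁ a (x ξ), hm'⟩) : T = S := by
  have hTS : T.domain = S.domain := hT.trans hS.symm
  have := eq_on_domain_of_eq_on_elementary hT (f := T.toFun)
    (g := S.toFun ∘ₗ Submodule.inclusion hTS.le) fun a x hx hm => h a x hx hm (hTS ▸ hm)
  exact LinearPMap.ext hTS fun z hz _ => congrArg (fun f => f ⟨z, hz⟩) this

theorem inner_eq_of_eq_on_elementary (hT : T.domain = elementarySpan tm₁ M ξ) {w : G₁} {y : G₂}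
    (h : ∀ (a : h₁) (x : H →L[ℂ] H), x ∈ M.commutant → ∀ hm : tm₁ a (x ξ) ∈ T.domain,
      ⟪w, tm₁ a (x ξ)⟫ = ⟪y, T ⟨tm₁ a (x ξ), hm⟩⟫) (z : T.domain) : ⟪w, (z : G₁)⟫ = ⟪y, T z⟫ :=
  congrArg (fun f => f z) <| eq_on_domain_of_eq_on_elementary hT
    (f := innerₛₗ ℂ w ∘ₗ T.domain.subtype) (g := innerₛₗ ℂ y ∘ₗ T.toFun) h

theorem amp_mem_elementarySpan
    (hamp : ∀ (u : H →L[ℂ] H) (a : h₁) (b : H), amp₁ u (tm₁ a b) = tm₁ a (u b))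
    {u : H →L[ℂ] H} (hu : u ∈ M.commutant) {z : G₁} (hz : z ∈ elementarySpan tm₁ M ξ) :
    amp₁ u z ∈ elementarySpan tm₁ M ξ := by
  have hle : elementarySpan tm₁ M ξ ≤ (elementarySpan tm₁ M ξ).comap (amp₁ u).toLinearMap := by
    refine Submodule.span_le.2 ?_
    rintro _ ⟨a, x, hx, rfl⟩
    change amp₁ u (tm₁ a (x ξ)) ∈ elementarySpan tm₁ M ξ
    rw [hamp]
    exact mem_elementarySpan a (x := u * x) (mul_mem hu hx)
  exact hle hz

/-- An operator in `Op_M` is determined by its values on the tensors `a ⊗ ξ`. -/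
theorem OpMOf.apply_elementary
    (hamp₁ : ∀ (u : H →L[ℂ] H) (a : h₁) (b : H), amp₁ u (tm₁ a b) = tm₁ a (u b))
    (hdense₂ : Dense (Submodule.span ℂ {z : G₂ | ∃ a b, z = tm₂ a b} : Set G₂))
    (hamp₂ : ∀ (u : H →L[ℂ] H) (a : h₂) (b : H), amp₂ u (tm₂ a b) = tm₂ a (u b))
    (hT : OpMOf M ξ tm₁ amp₁ amp₂ T) {B : h₁ → G₂}
    (hB : ∀ (a : h₁) (hm : tm₁ a ξ ∈ T.domain), T ⟨tm₁ a ξ, hm⟩ = B a)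
    (a : h₁) {x : H →L[ℂ] H} (hx : x ∈ M.commutant) (hm : tm₁ a (x ξ) ∈ T.domain) :
    T ⟨tm₁ a (x ξ), hm⟩ = amp₂ x (B a) := by
  have hdom : T.domain = elementarySpan tm₁ M ξ := hT.1
  have key : ∀ x ∈ Submodule.span ℂ {u : H →L[ℂ] H | u ∈ M.commutant ∧ u * star u = 1 ∧
      star u * u = 1}, ∃ hm : tm₁ a (x ξ) ∈ T.domain,
        T ⟨tm₁ a (x ξ), hm⟩ = amp₂ x (B a) := by
    intro x hx
    induction hx using Submodule.span_induction with
    | mem u hu =>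
      obtain ⟨hu, h1, h2⟩ := hu
      have hξ : tm₁ a ξ ∈ T.domain := hdom ▸ mem_elementarySpan_vector a
      have huξ : amp₁ u (tm₁ a ξ) ∈ T.domain := ((hT.2 u hu h1 h2).1 _).2 hξ
      have heq := (hT.2 u hu h1 h2).2 _ hξ huξ
      rw [hB] at heq
      refine ⟨hamp₁ u a ξ ▸ huξ, ?_⟩
      rw [← heq, ← mul_apply_eq_comp, ← amp_mul hdense₂ hamp₂, h1,
        amp_one hdense₂ hamp₂, one_apply_eq_self]
      simp only [hamp₁]
    | zero =>
      refine ⟨by simp, ?_⟩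
      have h0 : amp₂ 0 = 0 := by simpa using amp_smul hdense₂ hamp₂ 0 0
      have : (⟨tm₁ a ((0 : H →L[ℂ] H) ξ), by simp⟩ : T.domain) = 0 := Subtype.ext (by simp)
      rw [this, T.map_zero, h0, zero_apply]
    | add x y _ _ hx hy =>
      obtain ⟨hx, hTx⟩ := hx
      obtain ⟨hy, hTy⟩ := hy
      have hsum : tm₁ a ((x + y) ξ) = tm₁ a (x ξ) + tm₁ a (y ξ) := map_add (tm₁ a) _ _
      refine ⟨hsum ▸ add_mem hx hy, ?_⟩
      simp only [hsum]
      rw [amp_add hdense₂ hamp₂, add_apply (amp₂ x), ← hTx, ← hTy]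
      exact T.map_add ⟨_, hx⟩ ⟨_, hy⟩
    | smul c x _ hx =>
      obtain ⟨hx, hTx⟩ := hx
      have hsmul : tm₁ a ((c • x) ξ) = c • tm₁ a (x ξ) := map_smul (tm₁ a) _ _
      refine ⟨hsmul ▸ Submodule.smul_mem _ c hx, ?_⟩
      simp only [hsmul]
      rw [amp_smul hdense₂ hamp₂, smul_apply (f := amp₂ x), ← hTx]
      exact T.map_smul c ⟨_, hx⟩
  exact (key x (M.commutant.mem_span_unitary hx)).2

/-- The operator `B^ξ` with domain `h₁ ⊗̲ M′ξ` attached to a linear map `B : h₁ → h₂ ⊗ H`. -/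
theorem exists_extension (hcyc : Dense {y : H | ∃ x ∈ M, x ξ = y})
    (hinner₁ : ∀ (a c : h₁) (b d : H), ⟪tm₁ a b, tm₁ c d⟫ = ⟪a, c⟫ * ⟪b, d⟫)
    (hdense₂ : Dense (Submodule.span ℂ {z : G₂ | ∃ a b, z = tm₂ a b} : Set G₂))
    (hamp₂ : ∀ (u : H →L[ℂ] H) (a : h₂) (b : H), amp₂ u (tm₂ a b) = tm₂ a (u b))
    (B : h₁ →ₗ[ℂ] G₂) :
    ∃ T : G₁ →ₗ.[ℂ] G₂, T.domain = elementarySpan tm₁ M ξ ∧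
      ∀ (a : h₁) (x : H →L[ℂ] H), x ∈ M.commutant → ∀ hm : tm₁ a (x ξ) ∈ T.domain,
        T ⟨tm₁ a (x ξ), hm⟩ = amp₂ x (B a) := by
  let ev : M.commutant.toSubmodule →ₗ[ℂ] H :=
    (ContinuousLinearMap.apply ℂ H ξ).toLinearMap ∘ₗ M.commutant.toSubmodule.subtype
  have hev : Function.Injective ev := by
    rw [injective_iff_map_eq_zero]
    exact fun x hx => Subtype.ext (M.eq_zero_of_commutant_apply_eq_zero ξ hcyc x.2 hx)
  let J := TensorProduct.lift tm₁ ∘ₗ ev.lTensor h₁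
  have hJ : Function.Injective J := (lift_injective hinner₁).comp
    (Module.Flat.lTensor_preserves_injective_linearMap ev hev)
  let K := TensorProduct.lift (LinearMap.mk₂ ℂ
    (fun (a : h₁) (x : M.commutant.toSubmodule) => amp₂ x (B a))
    (fun _ _ _ => by simp) (fun _ _ _ => by simp)
    (fun _ _ _ => by simp [amp_add hdense₂ hamp₂])
    (fun _ _ _ => by simp [amp_smul hdense₂ hamp₂]))
  refine ⟨⟨LinearMap.range J, K ∘ₗ (LinearEquiv.ofInjective J hJ).symm⟩, le_antisymm ?_ ?_, ?_⟩
  · rintro _ ⟨t, rfl⟩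
    induction t with
    | zero => simp
    | add s t hs ht => rw [map_add]; exact add_mem hs ht
    | tmul a x => exact mem_elementarySpan a x.2
  · refine Submodule.span_le.2 ?_
    rintro _ ⟨a, x, hx, rfl⟩
    exact ⟨a ⊗ₜ[ℂ] (⟨x, hx⟩ : M.commutant.toSubmodule), rfl⟩
  · intro a x hx hm
    have : (LinearEquiv.ofInjective J hJ).symm ⟨tm₁ a (x ξ), hm⟩ =
        a ⊗ₜ[ℂ] (⟨x, hx⟩ : M.commutant.toSubmodule) := by
      rw [LinearEquiv.symm_apply_eq]
      rfl
    change K ((LinearEquiv.ofInjective J hJ).symm ⟨tm₁ a (x ξ), hm⟩) = _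
    rw [this]
    rfl

theorem opMOf_of_apply_elementary
    (hdense₁ : Dense (Submodule.span ℂ {z : G₁ | ∃ a b, z = tm₁ a b} : Set G₁))
    (hamp₁ : ∀ (u : H →L[ℂ] H) (a : h₁) (b : H), amp₁ u (tm₁ a b) = tm₁ a (u b))
    (hdense₂ : Dense (Submodule.span ℂ {z : G₂ | ∃ a b, z = tm₂ a b} : Set G₂))
    (hamp₂ : ∀ (u : H →L[ℂ] H) (a : h₂) (b : H), amp₂ u (tm₂ a b) = tm₂ a (u b))
    (hdom : T.domain = elementarySpan tm₁ M ξ) {B : h₁ → G₂}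
    (hB : ∀ (a : h₁) (x : H →L[ℂ] H), x ∈ M.commutant → ∀ hm : tm₁ a (x ξ) ∈ T.domain,
      T ⟨tm₁ a (x ξ), hm⟩ = amp₂ x (B a)) : OpMOf M ξ tm₁ amp₁ amp₂ T := by
  have hmaps : ∀ u ∈ M.commutant, ∀ z ∈ T.domain, amp₁ u z ∈ T.domain := by
    rw [hdom]
    exact fun u hu z hz => amp_mem_elementarySpan hamp₁ hu hz
  refine ⟨hdom, fun u hu h1 h2 => ⟨fun z => ⟨fun hz => ?_, hmaps u hu z⟩, ?_⟩⟩
  · have := hmaps (star u) (star_mem hu) _ hz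
    rwa [← mul_apply_eq_comp, ← amp_mul hdense₁ hamp₁, h2, amp_one hdense₁ hamp₁,
      one_apply_eq_self] at this
  · have := eq_on_domain_of_eq_on_elementary hdom
      (f := (amp₂ (star u)).toLinearMap ∘ₗ T.toFun ∘ₗ
        (amp₁ u).toLinearMap.restrict (hmaps u hu)) (g := T.toFun) (by
      intro a x hx hm
      have hm' : tm₁ a ((u * x) ξ) ∈ T.domain := hdom ▸ mem_elementarySpan a (mul_mem hu hx)
      have hux : (amp₁ u).toLinearMap.restrict (hmaps u hu) ⟨tm₁ a (x ξ), hm⟩ =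
        (⟨tm₁ a ((u * x) ξ), hm'⟩ : T.domain) := Subtype.ext (hamp₁ u a (x ξ))
      change amp₂ (star u) (T _) = T _
      rw [hux, hB a _ (mul_mem hu hx), hB a x hx, ← mul_apply_eq_comp,
        ← amp_mul hdense₂ hamp₂, ← mul_assoc, h2, one_mul])
    exact fun z hz _ => congrArg (fun f => f ⟨z, hz⟩) this

/-- The pairing identity expressing that `amp₁ x (B_† a)` is the value of `(B^ξ)*` at `a ⊗ xξ`. -/
theorem OpMOf.inner_amp_dagger [CompleteSpace G₁] [CompleteSpace G₂]
    (hinner₁ : ∀ (a c : h₁) (b d : H), ⟪tm₁ a b, tm₁ c d⟫ = ⟪a, c⟫ * ⟪b, d⟫)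
    (hdense₁ : Dense (Submodule.span ℂ {z : G₁ | ∃ a b, z = tm₁ a b} : Set G₁))
    (hamp₁ : ∀ (u : H →L[ℂ] H) (a : h₁) (b : H), amp₁ u (tm₁ a b) = tm₁ a (u b))
    (hinner₂ : ∀ (a c : h₂) (b d : H), ⟪tm₂ a b, tm₂ c d⟫ = ⟪a, c⟫ * ⟪b, d⟫)
    (hdense₂ : Dense (Submodule.span ℂ {z : G₂ | ∃ a b, z = tm₂ a b} : Set G₂))
    (hamp₂ : ∀ (u : H →L[ℂ] H) (a : h₂) (b : H), amp₂ u (tm₂ a b) = tm₂ a (u b))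
    (hT : OpMOf M ξ tm₁ amp₁ amp₂ T) {B : h₁ → G₂} {Bd : h₂ → G₁}
    (hB : ∀ (a : h₁) (hm : tm₁ a ξ ∈ T.domain), T ⟨tm₁ a ξ, hm⟩ = B a)
    (hBd : ∀ (c₁ : h₁) (c₂ : h₂) (x : H →L[ℂ] H), x ∈ M.commutant →
      ⟪tm₁ c₁ (x ξ), Bd c₂⟫ = ⟪B c₁, tm₂ c₂ ((star x) ξ)⟫)
    (a : h₂) {x : H →L[ℂ] H} (hx : x ∈ M.commutant) (z : T.domain) :
    ⟪amp₁ x (Bd a), (z : G₁)⟫ = ⟪tm₂ a (x ξ), T z⟫ := by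
  refine inner_eq_of_eq_on_elementary hT.1 (fun c y hy hm => ?_) z
  rw [hT.apply_elementary hamp₁ hdense₂ hamp₂ hB c hy, ← ContinuousLinearMap.adjoint_inner_right,
    ← amp_star hinner₁ hdense₁ hamp₁, hamp₁, ← ContinuousLinearMap.adjoint_inner_left,
    ← amp_star hinner₂ hdense₂ hamp₂, hamp₂, ← inner_conj_symm, ← inner_conj_symm (tm₂ _ _)]
  have := hBd c a (star x * y) (mul_mem (star_mem hx) hy)
  rw [star_mul, star_star] at this
  exact congrArg _ this

/-- If `h₂ ⊗̲ M′ξ` lies in the domain of the adjoint of `T ∈ Op_M`, then `T E_ξ` is bounded, and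
so is `T* E_ξ`, which serves as its dagger. -/
theorem exists_bounded_of_adjoint [CompleteSpace h₁] [CompleteSpace h₂]
    [CompleteSpace G₁] [CompleteSpace G₂]
    (hsep : ∀ x ∈ M, x ξ = 0 → x = 0)
    (hinner₁ : ∀ (a c : h₁) (b d : H), ⟪tm₁ a b, tm₁ c d⟫ = ⟪a, c⟫ * ⟪b, d⟫)
    (hdense₁ : Dense (Submodule.span ℂ {z : G₁ | ∃ a b, z = tm₁ a b} : Set G₁))
    (hamp₁ : ∀ (u : H →L[ℂ] H) (a : h₁) (b : H), amp₁ u (tm₁ a b) = tm₁ a (u b))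
    (hinner₂ : ∀ (a c : h₂) (b d : H), ⟪tm₂ a b, tm₂ c d⟫ = ⟪a, c⟫ * ⟪b, d⟫)
    (hdense₂ : Dense (Submodule.span ℂ {z : G₂ | ∃ a b, z = tm₂ a b} : Set G₂))
    (hamp₂ : ∀ (u : H →L[ℂ] H) (a : h₂) (b : H), amp₂ u (tm₂ a b) = tm₂ a (u b))
    (hT : OpMOf M ξ tm₁ amp₁ amp₂ T) (hadj : elementarySpan tm₂ M ξ ≤ T.adjoint.domain) :
    ∃ (B : h₁ →L[ℂ] G₂) (Bd : h₂ →L[ℂ] G₁),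
      (∀ (a : h₁) (hm : tm₁ a ξ ∈ T.domain), T ⟨tm₁ a ξ, hm⟩ = B a) ∧
      (∀ (c₁ : h₁) (c₂ : h₂) (x : H →L[ℂ] H), x ∈ M.commutant →
        ⟪tm₁ c₁ (x ξ), Bd c₂⟫ = ⟪(B c₁ : G₂), tm₂ c₂ ((star x) ξ)⟫) := by
  have hdom : T.domain = elementarySpan tm₁ M ξ := hT.1
  have hTd : Dense (T.domain : Set G₁) := by
    rw [hdom]
    exact dense_elementarySpan hsep hinner₁ hdense₁
  have hadj_inner : ∀ (y : T.adjoint.domain) (z : T.domain),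
      ⟪T.adjoint y, (z : G₁)⟫ = ⟪(y : G₂), T z⟫ :=
    T.adjoint_isFormalAdjoint hTd
  let B₀ : h₁ →ₗ[ℂ] G₂ := T.toFun ∘ₗ
    (tm₁.flip ξ).codRestrict T.domain fun a => hdom ▸ mem_elementarySpan_vector a
  let Bd₀ : h₂ →ₗ[ℂ] G₁ := T.adjoint.toFun ∘ₗ
    (tm₂.flip ξ).codRestrict T.adjoint.domain fun a => hadj (mem_elementarySpan_vector a)
  have hB₀ : ∀ (a : h₁) (hm : tm₁ a ξ ∈ T.domain), T ⟨tm₁ a ξ, hm⟩ = B₀ a := fun _ _ => rfl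
  have hBd₀ : ∀ (a : h₂) (z : T.domain), ⟪Bd₀ a, (z : G₁)⟫ = ⟪tm₂ a ξ, T z⟫ :=
    fun a z => hadj_inner ⟨tm₂ a ξ, hadj (mem_elementarySpan_vector a)⟩ z
  have hBcont : Continuous B₀ := by
    refine B₀.continuous_of_dense_inner (dense_elementarySpan hsep hinner₂ hdense₂) fun s hs => ?_
    have : (fun a => ⟪s, B₀ a⟫) = fun a => ⟪T.adjoint ⟨s, hadj hs⟩, tm₁ a ξ⟫ :=
      funext fun a => (hadj_inner ⟨s, hadj hs⟩ ⟨tm₁ a ξ, hdom ▸ mem_elementarySpan_vector a⟩).symm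
    rw [this]
    exact continuous_const.inner (continuous_elementary_left hinner₁ ξ)
  have hBdcont : Continuous Bd₀ := by
    refine Bd₀.continuous_of_dense_inner hTd fun s hs => ?_
    have : (fun a => ⟪s, Bd₀ a⟫) = fun a => ⟪T ⟨s, hs⟩, tm₂ a ξ⟫ := funext fun a => by
      rw [← inner_conj_symm, hBd₀ a ⟨s, hs⟩, inner_conj_symm]
    rw [this]
    exact continuous_const.inner (continuous_elementary_left hinner₂ ξ)
  refine ⟨⟨B₀, hBcont⟩, ⟨Bd₀, hBdcont⟩, hB₀, fun c₁ c₂ x hx => ?_⟩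
  change ⟪_, Bd₀ c₂⟫ = ⟪B₀ c₁, _⟫
  have hm : tm₁ c₁ (x ξ) ∈ T.domain := hdom ▸ mem_elementarySpan c₁ hx
  rw [← inner_conj_symm, hBd₀ c₂ ⟨_, hm⟩, inner_conj_symm,
    hT.apply_elementary hamp₁ hdense₂ hamp₂ hB₀ c₁ hx hm,
    ← ContinuousLinearMap.adjoint_inner_right, ← amp_star hinner₂ hdense₂ hamp₂, hamp₂]

end Operators

theorem stmt0 {H h₁ h₂ G₁ G₂ : Type*}
    [NormedAddCommGroup H] [InnerProductSpace ℂ H] [CompleteSpace H]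
    [NormedAddCommGroup h₁] [InnerProductSpace ℂ h₁] [CompleteSpace h₁]
    [NormedAddCommGroup h₂] [InnerProductSpace ℂ h₂] [CompleteSpace h₂]
    [NormedAddCommGroup G₁] [InnerProductSpace ℂ G₁] [CompleteSpace G₁]
    [NormedAddCommGroup G₂] [InnerProductSpace ℂ G₂] [CompleteSpace G₂]
    (M : VonNeumannAlgebra H) (ξ : H)
    -- `ξ` is cyclic and separating for `M`:
    (hcyclic : Dense {y : H | ∃ x ∈ M, x ξ = y})
    (hseparating : ∀ x ∈ M, x ξ = 0 → x = 0)
    -- `G₁ = h₁ ⊗ H` and `G₂ = h₂ ⊗ H`: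
    (tm₁ : h₁ →ₗ[ℂ] H →ₗ[ℂ] G₁)
    (htm₁_inner : ∀ (a c : h₁) (b d : H), ⟪tm₁ a b, tm₁ c d⟫ = ⟪a, c⟫ * ⟪b, d⟫)
    (htm₁_dense : Dense (Submodule.span ℂ {z : G₁ | ∃ a b, z = tm₁ a b} : Set G₁))
    (tm₂ : h₂ →ₗ[ℂ] H →ₗ[ℂ] G₂)
    (htm₂_inner : ∀ (a c : h₂) (b d : H), ⟪tm₂ a b, tm₂ c d⟫ = ⟪a, c⟫ * ⟪b, d⟫)
    (htm₂_dense : Dense (Submodule.span ℂ {z : G₂ | ∃ a b, z = tm₂ a b} : Set G₂))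
    -- the ampliations `u ↦ I ⊗ u`:
    (amp₁ : (H →L[ℂ] H) → (G₁ →L[ℂ] G₁))
    (hamp₁ : ∀ (u : H →L[ℂ] H) (a : h₁) (b : H), amp₁ u (tm₁ a b) = tm₁ a (u b))
    (amp₂ : (H →L[ℂ] H) → (G₂ →L[ℂ] G₂))
    (hamp₂ : ∀ (u : H →L[ℂ] H) (a : h₂) (b : H), amp₂ u (tm₂ a b) = tm₂ a (u b)) :
    -- (1) `T ↦ T E_ξ` is a bijection from `Op_M(h₁ ⊗̲ Ξ; h₂ ⊗ H)` onto all linear maps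
    --     `h₁ → G₂`, the inverse `B ↦ B^ξ` being given by the well-defined prescription
    --     `B^ξ (c ⊗ x′ξ) = (I ⊗ x′)(B c)`:
    (∀ B : h₁ →ₗ[ℂ] G₂,
      (∃! T : G₁ →ₗ.[ℂ] G₂, OpMOf M ξ tm₁ amp₁ amp₂ T ∧
        ∀ (a : h₁) (hm : tm₁ a ξ ∈ T.domain), T ⟨tm₁ a ξ, hm⟩ = B a) ∧
      (∀ T : G₁ →ₗ.[ℂ] G₂, OpMOf M ξ tm₁ amp₁ amp₂ T →
        (∀ (a : h₁) (hm : tm₁ a ξ ∈ T.domain), T ⟨tm₁ a ξ, hm⟩ = B a) →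
        ∀ (a : h₁) (x : H →L[ℂ] H), x ∈ M.commutant →
          ∀ hm : tm₁ a (x ξ) ∈ T.domain, T ⟨tm₁ a (x ξ), hm⟩ = amp₂ x (B a))) ∧
    -- (2) the bijection `T ↦ T E_ξ` is linear:
    (∀ T T' : G₁ →ₗ.[ℂ] G₂, OpMOf M ξ tm₁ amp₁ amp₂ T → OpMOf M ξ tm₁ amp₁ amp₂ T' →
      ∀ (c : ℂ) (a : h₁) (hm : tm₁ a ξ ∈ (T + c • T').domain)
        (hm₁ : tm₁ a ξ ∈ T.domain) (hm₂ : tm₁ a ξ ∈ T'.domain),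
        (T + c • T') ⟨tm₁ a ξ, hm⟩ = T ⟨tm₁ a ξ, hm₁⟩ + c • T' ⟨tm₁ a ξ, hm₂⟩) ∧
    -- (3) `T ∈ Op‡_M(h₁ ⊗̲ Ξ, h₂ ⊗̲ Ξ)` iff `T E_ξ ∈ B‡_{M,ξ}(h₁; h₂ ⊗ H)`:
    (∀ T : G₁ →ₗ.[ℂ] G₂, OpMOf M ξ tm₁ amp₁ amp₂ T →
      ((Submodule.span ℂ
          {z : G₂ | ∃ (a : h₂) (x : H →L[ℂ] H), x ∈ M.commutant ∧ z = tm₂ a (x ξ)}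
            ≤ T.adjoint.domain) ↔
        (∃ (B : h₁ →L[ℂ] G₂) (Bd : h₂ →L[ℂ] G₁),
          (∀ (a : h₁) (hm : tm₁ a ξ ∈ T.domain), T ⟨tm₁ a ξ, hm⟩ = B a) ∧
          (∀ (c₁ : h₁) (c₂ : h₂) (x : H →L[ℂ] H), x ∈ M.commutant →
            ⟪tm₁ c₁ (x ξ), Bd c₂⟫ = ⟪(B c₁ : G₂), tm₂ c₂ ((star x) ξ)⟫)))) ∧
    -- (4) the restricted bijection intertwines the dagger operations:
    --     `(T E_ξ)_† = T† E_ξ` and `(B^ξ)† = (B_†)^ξ`: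
    (∀ T : G₁ →ₗ.[ℂ] G₂, OpMOf M ξ tm₁ amp₁ amp₂ T →
      Submodule.span ℂ
          {z : G₂ | ∃ (a : h₂) (x : H →L[ℂ] H), x ∈ M.commutant ∧ z = tm₂ a (x ξ)}
        ≤ T.adjoint.domain →
      ∀ (B : h₁ →L[ℂ] G₂) (Bd : h₂ →L[ℂ] G₁),
        (∀ (a : h₁) (hm : tm₁ a ξ ∈ T.domain), T ⟨tm₁ a ξ, hm⟩ = B a) →
        (∀ (c₁ : h₁) (c₂ : h₂) (x : H →L[ℂ] H), x ∈ M.commutant →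
          ⟪tm₁ c₁ (x ξ), Bd c₂⟫ = ⟪(B c₁ : G₂), tm₂ c₂ ((star x) ξ)⟫) →
        (∀ (a : h₂) (hm : tm₂ a ξ ∈ T.adjoint.domain),
          T.adjoint ⟨tm₂ a ξ, hm⟩ = Bd a) ∧
        (∀ (a : h₂) (x : H →L[ℂ] H), x ∈ M.commutant →
          ∀ hm : tm₂ a (x ξ) ∈ T.adjoint.domain,
            T.adjoint ⟨tm₂ a (x ξ), hm⟩ = amp₁ x (Bd a))) := by
  refine ⟨fun B => ⟨?_, fun T hT hB a x hx hm =>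
      hT.apply_elementary hamp₁ htm₂_dense hamp₂ hB a hx hm⟩,
    fun T T' _ _ c a hm hm₁ hm₂ => rfl, fun T hT => ⟨fun hadj => ?_, ?_⟩, ?_⟩
  · obtain ⟨T, hdom, hTB⟩ := exists_extension (M := M) (ξ := ξ) hcyclic htm₁_inner htm₂_dense
      hamp₂ B
    refine ⟨T, ⟨opMOf_of_apply_elementary htm₁_dense hamp₁ htm₂_dense hamp₂ hdom hTB,
      fun a hm => ?_⟩, ?_⟩
    · have := hTB a 1 (one_mem _) hm
      rwa [amp_one htm₂_dense hamp₂] at this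
    · rintro S ⟨hS, hSB⟩
      refine ext_of_eq_on_elementary hS.1 hdom fun a x hx hm hm' => ?_
      rw [hS.apply_elementary hamp₁ htm₂_dense hamp₂ hSB a hx hm, hTB a x hx hm']
  · exact exists_bounded_of_adjoint hseparating htm₁_inner htm₁_dense hamp₁ htm₂_inner htm₂_dense
      hamp₂ hT hadj
  · rintro ⟨B, Bd, hB, hBd⟩
    refine Submodule.span_le.2 ?_
    rintro _ ⟨a, x, hx, rfl⟩
    exact T.mem_adjoint_domain_of_exists _ ⟨amp₁ x (Bd a),
      hT.inner_amp_dagger htm₁_inner htm₁_dense hamp₁ htm₂_inner htm₂_dense hamp₂ hB hBd a hx⟩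
  · intro T hT hadj B Bd hB hBd
    have hTd : Dense (T.domain : Set G₁) := by
      rw [hT.1]
      exact dense_elementarySpan hseparating htm₁_inner htm₁_dense
    have hdagger : ∀ (a : h₂) (x : H →L[ℂ] H), x ∈ M.commutant →
        ∀ hm : tm₂ a (x ξ) ∈ T.adjoint.domain,
          T.adjoint ⟨tm₂ a (x ξ), hm⟩ = amp₁ x (Bd a) := fun a x hx hm =>
      T.adjoint_apply_eq hTd _ (hT.inner_amp_dagger htm₁_inner htm₁_dense hamp₁ htm₂_inner
        htm₂_dense hamp₂ hB hBd a hx)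
    refine ⟨fun a hm => ?_, hdagger⟩
    have := hdagger a 1 (one_mem _) hm
    rwa [amp_one htm₁_dense hamp₁] at this
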